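/- Let ε ∈ (0,1/4] be a real number and set h_B = 13/ε², λ = 1/(ε − ε²), q = 2/ε². Then for every real W with 0 ≤ W ≤ (1 − 3ε)·q one has (1−ε)·(h_B − 1)·(W + q·ε) − λ ≥ h_B + ε + W·h_B. -/

import Mathlib

/-- Lemma (aligning q levels suffices): for `ε ∈ (0,1/4]`, `h_B = 13/ε²`,
`λ = 1/(ε − ε²)`, `q = 2/ε²` and `0 ≤ W ≤ (1−3ε)·q`,
`(1−ε)·(h_B − 1)·(W + q·ε) − λ ≥ h_B + ε + W·h_B`. -/
theorem stmt_13 (ε W : ℝ) (hε0 : 0 < ε) (hε1 : ε ≤ 1 / 4)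
    (hW0 : 0 ≤ W) (hW1 : W ≤ (1 - 3 * ε) * (2 / ε ^ 2)) :
    (1 - ε) * (13 / ε ^ 2 - 1) * (W + (2 / ε ^ 2) * ε) - 1 / (ε - ε ^ 2) ≥
      13 / ε ^ 2 + ε + W * (13 / ε ^ 2) := by
  have hden : 0 < ε - ε ^ 2 := by nlinarith
  have hcoef : 0 ≤ 13 / ε + 1 - ε := by
    have : 0 < 13 / ε := by positivity
    linarith
  have hW := mul_le_mul_of_nonneg_left hW1 hcoef
  have hlam : 1 / (ε - ε ^ 2) ≤ 2 / ε := by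
    rw [div_le_div_iff₀ hden hε0]
    nlinarith
  have hsplit : (1 - ε) * (13 / ε ^ 2 - 1) * (W + (2 / ε ^ 2) * ε)
      - (13 / ε ^ 2 + ε + W * (13 / ε ^ 2)) - 2 / ε
      = ((13 / ε + 1 - ε) * ((1 - 3 * ε) * (2 / ε ^ 2)) - (13 / ε + 1 - ε) * W)
        + (37 + 4 * ε - 4 * ε ^ 2 - ε ^ 3) / ε ^ 2 := by
    field_simp
    ring
  have hpos : 0 ≤ (37 + 4 * ε - 4 * ε ^ 2 - ε ^ 3) / ε ^ 2 := by
    apply div_nonneg _ (sq_nonneg ε)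
    have h2 : ε ^ 2 ≤ 1 := pow_le_one₀ hε0.le (by linarith)
    have h3 : ε ^ 3 ≤ 1 := pow_le_one₀ hε0.le (by linarith)
    linarith
  linarith
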